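/- arXiv:1912.03219 — 3 statements merged into one kernel-verified Lean document; each statement's English description precedes it below -/
import Mathlib

section
/- Fix 0<λ<1 and let q be the Borel(λ) mass function. Let W be a positive-integer-valued random variable with E[W] = (1−λ)^{-1}, let W⋆ be its size-biased version, let Z ~ Borel(λ) be independent of W⋆, and let f: ℕ→ℝ be bounded. Then (1−λ)E[(W−1)f(W)] − λ(1−λ)E[W ∑_{i=1}^{∞} f(i+W) q(i)] = E[f(W⋆)] − ((1−λ)E[f(W)] + λE[f(Z+W⋆)]). -/
open scoped BigOperators

/-- The Borel(λ) mass function: `q j = e^{-λ j}(λ j)^{j-1}/j!` for `j ≥ 1`, and `0` at `j = 0`. -/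
noncomputable def borelPMF (lam : ℝ) (j : ℕ) : ℝ :=
  if j = 0 then 0 else Real.exp (-(lam * j)) * (lam * j) ^ (j - 1) / (Nat.factorial j)

/-- The Borel mass function is dominated by a geometric sequence of ratio `λ e^{1-λ}`. -/
lemma borelPMF_le_geometric {lam : ℝ} (hlam : 0 < lam) (j : ℕ) :
    borelPMF lam j ≤ lam⁻¹ * (lam * Real.exp (1 - lam)) ^ j := by
  unfold borelPMF
  split_ifs with hj
  · positivity
  · have hj1 : (1 : ℝ) ≤ j := by exact_mod_cast Nat.one_le_iff_ne_zero.mpr hj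
    have hpow : (lam * j) ^ (j - 1) ≤ lam⁻¹ * (lam * j) ^ j := by
      rw [le_inv_mul_iff₀ hlam, ← pow_sub_one_mul hj, mul_comm]
      exact mul_le_mul_of_nonneg_left (le_mul_of_one_le_right hlam.le hj1) (by positivity)
    have hfact : (j : ℝ) ^ j / (j.factorial : ℝ) ≤ Real.exp j :=
      Real.pow_div_factorial_le_exp j (by positivity) j
    calc Real.exp (-(lam * j)) * (lam * j) ^ (j - 1) / (j.factorial : ℝ)
        ≤ Real.exp (-(lam * j)) * (lam⁻¹ * (lam * j) ^ j) / (j.factorial : ℝ) := by gcongr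
      _ = lam⁻¹ * lam ^ j * Real.exp (-(lam * j)) * ((j : ℝ) ^ j / (j.factorial : ℝ)) := by
          rw [mul_pow]; ring
      _ ≤ lam⁻¹ * lam ^ j * Real.exp (-(lam * j)) * Real.exp j := by gcongr
      _ = lam⁻¹ * (lam * Real.exp (1 - lam)) ^ j := by
          rw [mul_pow, ← Real.exp_nat_mul, mul_assoc (lam⁻¹ * lam ^ j), ← Real.exp_add, mul_assoc]
          ring_nf

lemma borelPMF_nonneg {lam : ℝ} (hlam : 0 ≤ lam) (j : ℕ) : 0 ≤ borelPMF lam j := by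
  unfold borelPMF
  split_ifs <;> positivity

lemma summable_borelPMF {lam : ℝ} (hlam0 : 0 < lam) (hlam1 : lam < 1) :
    Summable (borelPMF lam) := by
  have hratio : lam * Real.exp (1 - lam) < 1 := by
    have h := Real.add_one_lt_exp (sub_ne_zero.mpr hlam1.ne)
    rw [sub_add_cancel] at h
    calc lam * Real.exp (1 - lam) < Real.exp (lam - 1) * Real.exp (1 - lam) := by gcongr
      _ = 1 := by rw [← Real.exp_add]; simp
  exact Summable.of_nonneg_of_le (borelPMF_nonneg hlam0.le) (borelPMF_le_geometric hlam0)
    ((summable_geometric_of_lt_one (by positivity) hratio).mul_left _)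

/-- A bounded function is summable against a summable nonnegative weight. -/
lemma summable_bounded_mul {ι : Type*} {g w : ι → ℝ} {C : ℝ} (hg : ∀ i, |g i| ≤ C)
    (hw0 : ∀ i, 0 ≤ w i) (hw : Summable w) : Summable fun i => g i * w i :=
  Summable.of_norm_bounded (hw.mul_left C) fun i => by
    rw [Real.norm_eq_abs, abs_mul, abs_of_nonneg (hw0 i)]
    exact mul_le_mul_of_nonneg_right (hg i) (hw0 i)

/-- The identity (2.4) behind the Borel Stein equation: for `W` positive-integer-valued with
mean `(1-λ)⁻¹`, size-biased version `W⋆`, `Z ~ Borel(λ)` independent of `W⋆`, and bounded `f`,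
`(1-λ)E[(W-1)f(W)] - λ(1-λ)E[W ∑_{i≥1} f(i+W)q(i)]
  = E[f(W⋆)] - ((1-λ)E[f(W)] + λ E[f(Z+W⋆)])`. -/
theorem borel_stein_identity (lam : ℝ) (hlam0 : 0 < lam) (hlam1 : lam < 1)
    (p : ℕ → ℝ) (hp0 : p 0 = 0) (hpnn : ∀ k, 0 ≤ p k) (hpsum : ∑' k, p k = 1)
    (hmean : ∑' k : ℕ, (k : ℝ) * p k = (1 - lam)⁻¹)
    (pStar : ℕ → ℝ) (hpStar : ∀ k, pStar k = (1 - lam) * (k : ℝ) * p k)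
    (f : ℕ → ℝ) (hf : ∃ C, ∀ n, |f n| ≤ C) :
    (1 - lam) * (∑' k : ℕ, ((k : ℝ) - 1) * f k * p k)
      - lam * (1 - lam) *
          (∑' k : ℕ, (k : ℝ) * p k * ∑' i : ℕ, f (i + k) * borelPMF lam i)
      = (∑' k : ℕ, f k * pStar k)
        - ((1 - lam) * (∑' k : ℕ, f k * p k)
            + lam * ∑' i : ℕ, ∑' k : ℕ, borelPMF lam i * pStar k * f (i + k)) := by
  obtain ⟨C, hC⟩ := hf
  have hp : Summable p := by
    by_contra h
    simp [tsum_eq_zero_of_not_summable h] at hpsum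
  have hkp : Summable fun k : ℕ => (k : ℝ) * p k := by
    by_contra h
    rw [tsum_eq_zero_of_not_summable h] at hmean
    exact inv_ne_zero (sub_pos.mpr hlam1).ne' hmean.symm
  have hkp0 : ∀ k : ℕ, 0 ≤ (k : ℝ) * p k := fun k => mul_nonneg k.cast_nonneg (hpnn k)
  have hq0 := borelPMF_nonneg hlam0.le
  have hjoint : Summable fun x : ℕ × ℕ =>
      f (x.1 + x.2) * (borelPMF lam x.1 * ((x.2 : ℝ) * p x.2)) :=
    summable_bounded_mul (fun x => hC (x.1 + x.2)) (fun x => mul_nonneg (hq0 x.1) (hkp0 x.2))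
      ((summable_borelPMF hlam0 hlam1).mul_of_nonneg hkp hq0 hkp0)
  have hfubini : ∑' i : ℕ, ∑' k : ℕ, borelPMF lam i * pStar k * f (i + k)
      = (1 - lam) * ∑' k : ℕ, (k : ℝ) * p k * ∑' i : ℕ, f (i + k) * borelPMF lam i := by
    calc ∑' i : ℕ, ∑' k : ℕ, borelPMF lam i * pStar k * f (i + k)
        = ∑' i : ℕ, ∑' k : ℕ,
            (1 - lam) * (f (i + k) * (borelPMF lam i * ((k : ℝ) * p k))) := by
          refine tsum_congr fun i => tsum_congr fun k => ?_
          rw [hpStar]; ring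
      _ = (1 - lam) * ∑' k : ℕ, ∑' i : ℕ,
            f (i + k) * (borelPMF lam i * ((k : ℝ) * p k)) := by
          rw [Summable.tsum_comm (f := fun i k : ℕ =>
            f (i + k) * (borelPMF lam i * ((k : ℝ) * p k))) hjoint, ← tsum_mul_left]
          exact tsum_congr fun i => tsum_mul_left
      _ = _ := by
          congr 1
          refine tsum_congr fun k => ?_
          rw [← tsum_mul_left]
          exact tsum_congr fun i => by ring
  have hsizeBias : ∑' k : ℕ, f k * pStar k = (1 - lam) * ∑' k : ℕ, f k * ((k : ℝ) * p k) := by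
    rw [← tsum_mul_left]
    exact tsum_congr fun k => by rw [hpStar]; ring
  have hsub : ∑' k : ℕ, ((k : ℝ) - 1) * f k * p k
      = ∑' k : ℕ, f k * ((k : ℝ) * p k) - ∑' k : ℕ, f k * p k := by
    rw [← (summable_bounded_mul hC hkp0 hkp).tsum_sub (summable_bounded_mul hC hpnn hp)]
    exact tsum_congr fun k => by ring
  rw [hfubini, hsizeBias, hsub]
  ring
end

section
/- Let Z ~ Borel(λ) with 0<λ<1, so that E[Z] = (1−λ)^{-1} and Var(Z) = λ(1−λ)^{-3}. Then for all t > 0, P( (Z − E[Z])/√(Var(Z)) ≤ −t ) ≤ exp{−t²/2}. -/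
open scoped BigOperators

/-- The Abel polynomial `y (y + n)^(n - 1)`, equal to `1` for `n = 0`. -/
noncomputable def abelPoly : ℕ → ℝ → ℝ
  | 0, _ => 1
  | m + 1, y => y * (y + (m + 1)) ^ m

lemma hasDerivAt_abelPoly_succ (m : ℕ) (y : ℝ) :
    HasDerivAt (abelPoly (m + 1)) ((m + 1) * abelPoly m (y + 1)) y := by
  have h : HasDerivAt (fun y : ℝ => y * (y + (m + 1)) ^ m)
      (1 * (y + (m + 1)) ^ m + y * (m * (y + (m + 1)) ^ (m - 1) * 1)) y :=
    (hasDerivAt_id y).mul (((hasDerivAt_id y).add_const _).fun_pow m)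
  refine h.congr_deriv ?_
  cases m with
  | zero => simp [abelPoly]
  | succ k =>
    simp only [abelPoly, Nat.add_sub_cancel]
    push_cast
    ring

/-- Abel's binomial identity. -/
lemma sum_choose_mul_abelPoly (n : ℕ) (z : ℝ) : ∀ y : ℝ,
    ∑ i ∈ Finset.range (n + 1),
      (n.choose i : ℝ) * abelPoly i y * (z + (n - i : ℕ)) ^ (n - i) = (y + z + n) ^ n := by
  induction n with
  | zero => intro y; simp [abelPoly]
  | succ n ih =>
    set F : ℝ → ℝ := fun y => ∑ i ∈ Finset.range (n + 1 + 1),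
      ((n + 1).choose i : ℝ) * abelPoly i y * (z + (n + 1 - i : ℕ)) ^ (n + 1 - i) with hF
    have hF' : ∀ y, HasDerivAt F ((n + 1) * (y + z + (n + 1)) ^ n) y := by
      intro y
      have hsum : ((n : ℝ) + 1) * (y + z + (n + 1)) ^ n = ∑ i ∈ Finset.range (n + 1),
          ((n + 1).choose (i + 1) : ℝ) * ((i + 1) * abelPoly i (y + 1)) *
            (z + (n - i : ℕ)) ^ (n - i) + 0 := by
        rw [add_zero, show y + z + ((n : ℝ) + 1) = y + 1 + z + n by ring, ← ih (y + 1),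
          Finset.mul_sum]
        refine Finset.sum_congr rfl fun i _ => ?_
        have hc : ((n : ℝ) + 1) * n.choose i = (n + 1).choose (i + 1) * (i + 1) := by
          exact_mod_cast Nat.add_one_mul_choose_eq n i
        linear_combination abelPoly i (y + 1) * (z + (n - i : ℕ)) ^ (n - i) * hc
      have hFs : F = fun y => ∑ i ∈ Finset.range (n + 1),
          ((n + 1).choose (i + 1) : ℝ) * abelPoly (i + 1) y * (z + (n - i : ℕ)) ^ (n - i) +
            (z + (n + 1 : ℕ)) ^ (n + 1) := by
        funext y
        simp only [hF]
        rw [Finset.sum_range_succ']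
        simp [abelPoly]
      rw [hFs, hsum]
      refine HasDerivAt.add (HasDerivAt.fun_sum fun i _ => ?_) (hasDerivAt_const _ _)
      exact ((hasDerivAt_abelPoly_succ i y).const_mul _).mul_const _
    have hR : ∀ y : ℝ, HasDerivAt (fun y : ℝ => (y + z + (n + 1)) ^ (n + 1))
        ((n + 1) * (y + z + (n + 1)) ^ n) y := by
      intro y
      have h := (((hasDerivAt_id y).add_const z).add_const ((n : ℝ) + 1)).fun_pow (n + 1)
      simpa using h
    have h0 : F 0 = (0 + z + (n + 1)) ^ (n + 1) := by
      simp only [hF]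
      rw [Finset.sum_range_succ', Finset.sum_eq_zero]
      · simp [abelPoly]
      · intro i _
        simp [abelPoly]
    have hD : ∀ y, HasDerivAt (fun y => F y - (y + z + (n + 1)) ^ (n + 1)) 0 y := by
      intro y
      simpa using (hF' y).fun_sub (hR y)
    intro y
    have := is_const_of_deriv_eq_zero (fun y => (hD y).differentiableAt)
      (fun y => (hD y).deriv) y 0
    simp only [h0, sub_self] at this
    push_cast
    linarith [this]

/-- The shifted tree-function coefficient `(i + 1)^i / (i + 1)!`. -/
noncomputable def treeCoeff (i : ℕ) : ℝ := ((i : ℝ) + 1) ^ i / (i + 1).factorial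

lemma treeCoeff_nonneg (i : ℕ) : 0 ≤ treeCoeff i := by
  unfold treeCoeff; positivity

lemma treeCoeff_eq_abelPoly (i : ℕ) : treeCoeff i = abelPoly i 1 / i.factorial := by
  cases i with
  | zero => simp [treeCoeff, abelPoly]
  | succ m =>
    have := Nat.factorial_pos (m + 1)
    rw [treeCoeff, abelPoly, Nat.factorial_succ (m + 1)]
    push_cast
    field_simp
    ring

lemma treeCoeff_recurrence (n : ℕ) :
    ((n : ℝ) + 1) * treeCoeff (n + 1) =
      ∑ i ∈ Finset.range (n + 1), treeCoeff i * (((n - i : ℕ) + 1) * treeCoeff (n - i)) := by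
  have hterm : ∀ i ∈ Finset.range (n + 1),
      treeCoeff i * (((n - i : ℕ) + 1) * treeCoeff (n - i)) =
      (n.choose i : ℝ) * abelPoly i 1 * (1 + (n - i : ℕ)) ^ (n - i) / n.factorial := by
    intro i hi
    have hle : i ≤ n := Nat.lt_succ_iff.mp (Finset.mem_range.mp hi)
    rw [treeCoeff_eq_abelPoly i, treeCoeff, Nat.choose_eq_factorial_div_factorial hle,
      Nat.cast_div (Nat.factorial_mul_factorial_dvd_factorial hle) (by positivity),
      Nat.factorial_succ]
    push_cast
    field_simp
    ring
  rw [Finset.sum_congr rfl hterm, ← Finset.sum_div, sum_choose_mul_abelPoly n 1 1, treeCoeff,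
    Nat.factorial_succ, Nat.factorial_succ]
  push_cast
  field_simp
  ring

/-- The truncated tree series divided by its variable. -/
noncomputable def treeSum (N : ℕ) (x : ℝ) : ℝ := ∑ i ∈ Finset.range N, treeCoeff i * x ^ i

lemma treeSum_nonneg (N : ℕ) {x : ℝ} (hx : 0 ≤ x) : 0 ≤ treeSum N x :=
  Finset.sum_nonneg fun i _ => mul_nonneg (treeCoeff_nonneg i) (pow_nonneg hx i)

lemma hasDerivAt_treeSum (N : ℕ) (x : ℝ) :
    HasDerivAt (treeSum (N + 1)) (∑ i ∈ Finset.range N, (i + 1) * treeCoeff (i + 1) * x ^ i) x := by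
  have h : HasDerivAt (treeSum (N + 1))
      (∑ i ∈ Finset.range (N + 1), treeCoeff i * (i * x ^ (i - 1))) x :=
    HasDerivAt.fun_sum fun i _ => (hasDerivAt_pow i x).const_mul _
  convert h using 1
  rw [Finset.sum_range_succ']
  simp only [Nat.add_sub_cancel, Nat.cast_zero, zero_mul, mul_zero, add_zero]
  refine Finset.sum_congr rfl fun i _ => ?_
  push_cast
  ring

lemma hasDerivAt_mul_treeSum (N : ℕ) (x : ℝ) :
    HasDerivAt (fun x => x * treeSum N x)
      (∑ i ∈ Finset.range N, (i + 1) * treeCoeff i * x ^ i) x := by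
  have hfun : (fun x => x * treeSum N x) =
      fun x => ∑ i ∈ Finset.range N, treeCoeff i * x ^ (i + 1) := by
    funext x
    rw [treeSum, Finset.mul_sum]
    exact Finset.sum_congr rfl fun i _ => by ring
  have h : HasDerivAt (fun x => ∑ i ∈ Finset.range N, treeCoeff i * x ^ (i + 1))
      (∑ i ∈ Finset.range N, treeCoeff i * ((i + 1 : ℕ) * x ^ i)) x :=
    HasDerivAt.fun_sum fun i _ => (hasDerivAt_pow (i + 1) x).const_mul _
  rw [hfun]
  convert h using 1
  refine Finset.sum_congr rfl fun i _ => ?_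
  push_cast
  ring

lemma deriv_treeSum_le (N : ℕ) {x : ℝ} (hx : 0 ≤ x) :
    ∑ i ∈ Finset.range N, (i + 1) * treeCoeff (i + 1) * x ^ i ≤
      treeSum (N + 1) x * ∑ i ∈ Finset.range (N + 1), (i + 1) * treeCoeff i * x ^ i := by
  have hflip : ∑ n ∈ Finset.range N, ((n : ℝ) + 1) * treeCoeff (n + 1) * x ^ n =
      ∑ i ∈ Finset.range N, ∑ k ∈ Finset.range (N - i),
        treeCoeff i * x ^ i * ((k + 1) * treeCoeff k * x ^ k) := by
    rw [← Finset.sum_range_diag_flip N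
      (fun i k => treeCoeff i * x ^ i * (((k : ℝ) + 1) * treeCoeff k * x ^ k))]
    refine Finset.sum_congr rfl fun n _ => ?_
    rw [treeCoeff_recurrence, Finset.sum_mul]
    refine Finset.sum_congr rfl fun i hi => ?_
    have hle : i ≤ n := Nat.lt_succ_iff.mp (Finset.mem_range.mp hi)
    rw [show x ^ n = x ^ i * x ^ (n - i) by rw [← pow_add, Nat.add_sub_cancel' hle]]
    ring
  have hnn : ∀ i k : ℕ, 0 ≤ treeCoeff i * x ^ i * ((k + 1) * treeCoeff k * x ^ k) := by
    intro i k
    have := treeCoeff_nonneg i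
    have := treeCoeff_nonneg k
    positivity
  rw [hflip, treeSum, Finset.sum_mul_sum]
  refine (Finset.sum_le_sum fun i _ => ?_).trans
    (Finset.sum_le_sum_of_subset_of_nonneg (Finset.range_mono N.le_succ)
      fun i _ _ => Finset.sum_nonneg fun k _ => hnn i k)
  exact Finset.sum_le_sum_of_subset_of_nonneg (Finset.range_mono (by omega)) fun k _ _ => hnn i k

lemma treeSum_le_exp (N : ℕ) {x : ℝ} (hx : 0 ≤ x) :
    treeSum (N + 1) x ≤ Real.exp (x * treeSum (N + 1) x) := by
  set G : ℝ → ℝ := fun x => treeSum (N + 1) x * Real.exp (-(x * treeSum (N + 1) x)) with hG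
  have hd := fun x => (hasDerivAt_treeSum N x).fun_mul (hasDerivAt_mul_treeSum (N + 1) x).fun_neg.exp
  have hanti : AntitoneOn G (Set.Ici 0) := by
    refine antitoneOn_of_deriv_nonpos (convex_Ici 0)
      (fun y _ => (hd y).continuousAt.continuousWithinAt)
      (fun y _ => (hd y).differentiableAt.differentiableWithinAt) fun y hy => ?_
    rw [interior_Ici] at hy
    have h1 := deriv_treeSum_le N (le_of_lt hy)
    have h2 : deriv G y = _ := (hd y).deriv
    rw [h2]
    have h3 := Real.exp_pos (-(y * treeSum (N + 1) y))
    nlinarith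
  have h := hanti (Set.mem_Ici.mpr le_rfl) (Set.mem_Ici.mpr hx) hx
  have h0 : G 0 = 1 := by
    simp only [hG, treeSum]
    rw [Finset.sum_range_succ']
    simp [treeCoeff]
  rw [h0] at h
  simp only [hG] at h
  rwa [Real.exp_neg, ← div_eq_mul_inv, div_le_one (Real.exp_pos _)] at h

lemma mul_treeSum_le (N : ℕ) {u : ℝ} (hu0 : 0 ≤ u) (hu1 : u < 1) :
    u * Real.exp (-u) * treeSum (N + 1) (u * Real.exp (-u)) ≤ u := by
  by_contra! hlt
  set x₀ := u * Real.exp (-u) with hx₀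
  have hx₀nn : 0 ≤ x₀ := by positivity
  obtain ⟨c, huc, hc⟩ := exists_between (lt_min hlt hu1)
  have hc1 : c < 1 := hc.trans_le (min_le_right _ _)
  have hcA : c ≤ x₀ * treeSum (N + 1) x₀ := (hc.trans_le (min_le_left _ _)).le
  have hcont : ContinuousOn (fun x => x * treeSum (N + 1) x) (Set.Icc 0 x₀) := fun y _ =>
    (hasDerivAt_mul_treeSum (N + 1) y).continuousAt.continuousWithinAt
  obtain ⟨x, hx, hxc⟩ := intermediate_value_Icc hx₀nn hcont
    (show c ∈ Set.Icc _ _ from ⟨by simpa using hu0.trans huc.le, hcA⟩)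
  simp only at hxc
  have h1 := treeSum_le_exp N hx.1
  rw [hxc] at h1
  have h2 : c ≤ u * Real.exp (c - u) := by
    calc c = x * treeSum (N + 1) x := hxc.symm
      _ ≤ x₀ * Real.exp c := mul_le_mul hx.2 h1 (treeSum_nonneg _ hx.1) hx₀nn
      _ = u * Real.exp (c - u) := by rw [hx₀, mul_assoc, ← Real.exp_add]; ring_nf
  have h3 := Real.add_one_le_exp (-(c - u))
  have h4 : Real.exp (c - u) * Real.exp (-(c - u)) = 1 := by
    rw [← Real.exp_add]; simp
  have h5 : c * Real.exp (-(c - u)) ≤ u := by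
    calc c * Real.exp (-(c - u)) ≤ u * Real.exp (c - u) * Real.exp (-(c - u)) := by gcongr
      _ = u := by rw [mul_assoc, h4, mul_one]
  have h6 : 0 < c := hu0.trans_lt huc
  nlinarith [mul_le_mul_of_nonneg_left h3 h6.le, mul_pos (sub_pos.mpr huc) (sub_pos.mpr hc1)]

lemma borelPMF_succ (u : ℝ) (i : ℕ) :
    borelPMF u (i + 1) = Real.exp (-u) * (treeCoeff i * (u * Real.exp (-u)) ^ i) := by
  rw [borelPMF, if_neg i.succ_ne_zero, treeCoeff, Nat.add_sub_cancel, mul_pow, mul_pow,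
    ← Real.exp_nat_mul,
    show -(u * ((i + 1 : ℕ) : ℝ)) = -u + i * -u by push_cast; ring, Real.exp_add]
  push_cast
  ring

lemma borelPMF_nonneg_s8 {u : ℝ} (hu : 0 ≤ u) (j : ℕ) : 0 ≤ borelPMF u j := by
  unfold borelPMF
  split_ifs <;> positivity

lemma sum_borelPMF_le_one (N : ℕ) {u : ℝ} (hu0 : 0 ≤ u) (hu1 : u < 1) :
    ∑ j ∈ Finset.range N, borelPMF u j ≤ 1 := by
  have hx : 0 ≤ u * Real.exp (-u) := by positivity
  calc ∑ j ∈ Finset.range N, borelPMF u j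
      ≤ ∑ j ∈ Finset.range (N + 1 + 1), borelPMF u j :=
        Finset.sum_le_sum_of_subset_of_nonneg (Finset.range_mono (by omega))
          fun j _ _ => borelPMF_nonneg_s8 hu0 j
    _ = Real.exp (-u) * treeSum (N + 1) (u * Real.exp (-u)) := by
        rw [Finset.sum_range_succ', treeSum, Finset.mul_sum]
        simp only [borelPMF_succ]
        simp [borelPMF]
    _ ≤ Real.exp (-u) * Real.exp u := by
        gcongr
        exact (treeSum_le_exp N hx).trans (Real.exp_le_exp.mpr (mul_treeSum_le N hu0 hu1))
    _ = 1 := by rw [← Real.exp_add]; simp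

/-- The Chernoff exponent of the Borel family is dominated by the Gaussian one. -/
lemma borel_exponent_le {lam m a : ℝ} (hm : 0 < m) (hml : m < lam) (hlam1 : lam < 1)
    (ha : a ≤ (1 - m)⁻¹) :
    (a - 1) * Real.log (lam / m) - (lam - m) * a ≤
      -((lam - m) ^ 2 * (1 - lam) / (2 * lam * (1 - m) ^ 2)) := by
  have hlam : 0 < lam := hm.trans hml
  have hm1 : 0 < 1 - m := by linarith
  set L := Real.log (lam / m) with hL
  have hpos : 0 < lam / m := by positivity
  have hLlow : lam - m ≤ L := by
    have h := Real.one_sub_inv_le_log_of_pos hpos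
    rw [inv_div] at h
    have : lam - m ≤ 1 - m / lam := by
      rw [le_sub_iff_add_le, ← le_sub_iff_add_le', div_le_iff₀ hlam]
      nlinarith
    linarith
  have hLup : m * L ≤ (lam ^ 2 - m ^ 2) / (2 * lam) := by
    have h0 : 0 ≤ L := by linarith
    have h := Real.self_le_sinh_iff.mpr h0
    rw [hL, Real.sinh_log hpos, ← hL] at h
    calc m * L ≤ m * ((lam / m - (lam / m)⁻¹) / 2) := by gcongr
      _ = _ := by field_simp
  calc (a - 1) * L - (lam - m) * a = a * (L - (lam - m)) - L := by ring
    _ ≤ (1 - m)⁻¹ * (L - (lam - m)) - L := by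
        gcongr
    _ = (1 - m)⁻¹ * (m * L - (lam - m)) := by field_simp; ring
    _ ≤ (1 - m)⁻¹ * ((lam ^ 2 - m ^ 2) / (2 * lam) - (lam - m)) := by gcongr
    _ = -((lam - m) ^ 2 * (1 - m) / (2 * lam * (1 - m) ^ 2)) := by field_simp; ring
    _ ≤ _ := by gcongr

lemma borelPMF_le_exp_mul {lam m : ℝ} (hm : 0 ≤ m) (hml : m < lam) (hlam1 : lam < 1) {j : ℕ}
    (hj : (j : ℝ) ≤ (1 - m)⁻¹) :
    borelPMF lam j ≤
      Real.exp (-((lam - m) ^ 2 * (1 - lam) / (2 * lam * (1 - m) ^ 2))) * borelPMF m j := by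
  cases j with
  | zero => simp [borelPMF]
  | succ i =>
    rcases hm.eq_or_lt with rfl | hm
    · have hi : i = 0 := by
        have : ((i + 1 : ℕ) : ℝ) ≤ (1 : ℕ) := by simpa using hj
        have := Nat.cast_le.mp this
        omega
      subst hi
      have : lam ^ 2 * (1 - lam) / (2 * lam) ≤ lam := by
        rw [div_le_iff₀ (by linarith)]
        nlinarith [pow_pos hml 3, pow_pos hml 2]
      simpa [borelPMF] using this
    · have hlam : 0 < lam := hm.trans hml
      have hexp := Real.exp_le_exp.mpr (borel_exponent_le hm hml hlam1 hj)
      have hratio : borelPMF lam (i + 1) = Real.exp ((((i + 1 : ℕ) : ℝ) - 1) *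
          Real.log (lam / m) - (lam - m) * (i + 1 : ℕ)) * borelPMF m (i + 1) := by
        have h1 : Real.exp ((((i + 1 : ℕ) : ℝ) - 1) * Real.log (lam / m) -
            (lam - m) * (i + 1 : ℕ)) =
            (lam / m) ^ i * (Real.exp (-(lam * (i + 1 : ℕ))) * Real.exp (m * (i + 1 : ℕ))) := by
          rw [← Real.exp_add, ← Real.exp_log (show 0 < (lam / m) ^ i by positivity),
            ← Real.exp_add, Real.log_pow]
          congr 1
          push_cast
          ring
        have h2 : Real.exp (m * (i + 1 : ℕ)) * Real.exp (-(m * (i + 1 : ℕ))) = 1 := by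
          rw [← Real.exp_add]; simp
        rw [h1, borelPMF, borelPMF, if_neg i.succ_ne_zero, if_neg i.succ_ne_zero,
          Nat.add_sub_cancel, mul_pow, mul_pow, div_pow]
        field_simp
        rw [mul_comm m] at h2
        linear_combination -h2
      rw [hratio]
      exact mul_le_mul_of_nonneg_right hexp (borelPMF_nonneg_s8 hm.le _)

/-- The lower-tail concentration bound for `Z ~ Borel(λ)` (with `E[Z] = (1-λ)⁻¹` and
`Var(Z) = λ(1-λ)⁻³`): for every `t > 0`,
`P((Z - E[Z])/√Var(Z) ≤ -t) ≤ exp(-t²/2)`. -/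
theorem borel_lower_tail (lam : ℝ) (hlam0 : 0 < lam) (hlam1 : lam < 1) (t : ℝ) (ht : 0 < t) :
    (∑' j : ℕ, if ((j : ℝ) - (1 - lam)⁻¹) / Real.sqrt (lam / (1 - lam) ^ 3) ≤ -t
        then borelPMF lam j else 0)
      ≤ Real.exp (-t ^ 2 / 2) := by
  have h1l : 0 < 1 - lam := by linarith
  set s := Real.sqrt (lam / (1 - lam) ^ 3) with hs
  have hspos : 0 < s := Real.sqrt_pos.mpr (by positivity)
  have hs2 : s ^ 2 = lam / (1 - lam) ^ 3 := Real.sq_sqrt (by positivity)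
  set a := (1 - lam)⁻¹ - t * s with ha
  have hiff : ∀ j : ℕ, ((j : ℝ) - (1 - lam)⁻¹) / s ≤ -t ↔ (j : ℝ) ≤ a := by
    intro j
    rw [div_le_iff₀ hspos, ha]
    constructor <;> intro h <;> linarith
  simp only [hiff]
  rcases lt_or_ge a 1 with ha1 | ha1
  · have hz : ∀ j : ℕ, (if (j : ℝ) ≤ a then borelPMF lam j else 0) = 0 := by
      intro j
      split_ifs with hj
      · have : j = 0 := by
          have : (j : ℝ) < (1 : ℕ) := by simpa using hj.trans_lt ha1
          have := Nat.cast_lt.mp this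
          omega
        simp [this, borelPMF]
      · rfl
    simp only [hz, tsum_zero]
    positivity
  · have ha0 : 0 < a := by linarith
    set m := 1 - a⁻¹ with hm
    have hma : (1 - m)⁻¹ = a := by simp [hm]
    have hm0 : 0 ≤ m := sub_nonneg.mpr (inv_le_one_of_one_le₀ ha1)
    have hml : m < lam := by
      have h : a < (1 - lam)⁻¹ := by have := mul_pos ht hspos; linarith
      have := (lt_inv_comm₀ ha0 h1l).mp h
      linarith
    have hm1 : 0 < 1 - m := by linarith
    have hexpo : (lam - m) ^ 2 * (1 - lam) / (2 * lam * (1 - m) ^ 2) = t ^ 2 / 2 := by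
      have hts : t * s = (1 - lam)⁻¹ - (1 - m)⁻¹ := by rw [hma, ha]; ring
      have h2 : t ^ 2 * (lam / (1 - lam) ^ 3) = ((1 - lam)⁻¹ - (1 - m)⁻¹) ^ 2 := by
        rw [← hs2, ← hts]; ring
      have h3 : t ^ 2 = ((1 - lam)⁻¹ - (1 - m)⁻¹) ^ 2 * ((1 - lam) ^ 3 / lam) := by
        rw [← h2]; field_simp
      rw [h3]
      field_simp
      ring
    set N := ⌊a⌋₊ + 1
    have hout : ∀ j ∉ Finset.range N, (if (j : ℝ) ≤ a then borelPMF lam j else 0) = 0 := by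
      intro j hj
      refine if_neg fun hja => hj (Finset.mem_range.mpr ?_)
      exact Nat.lt_succ_of_le (Nat.le_floor hja)
    rw [tsum_eq_sum hout]
    calc ∑ j ∈ Finset.range N, (if (j : ℝ) ≤ a then borelPMF lam j else 0)
        ≤ ∑ j ∈ Finset.range N, Real.exp (-t ^ 2 / 2) * borelPMF m j := by
          refine Finset.sum_le_sum fun j _ => ?_
          split_ifs with hj
          · have h := borelPMF_le_exp_mul hm0 hml hlam1 (hj.trans_eq hma.symm)
            rwa [hexpo, ← neg_div] at h
          · exact mul_nonneg (Real.exp_pos _).le (borelPMF_nonneg_s8 hm0 j)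
      _ = Real.exp (-t ^ 2 / 2) * ∑ j ∈ Finset.range N, borelPMF m j := by rw [Finset.mul_sum]
      _ ≤ Real.exp (-t ^ 2 / 2) * 1 := by
          gcongr
          exact sum_borelPMF_le_one N hm0 (by linarith)
      _ = Real.exp (-t ^ 2 / 2) := mul_one _
end

section
/- Let 0<λ<1 and δ > 0 be such that γ := λ − log(λ) − 1 − δ > 0, and let Z⋆ be the size-biased version of Z ~ Borel(λ), i.e. P(Z⋆ = j) = (1−λ) j e^{−λj}(λj)^{j−1}/j!. Then E[Z⋆ e^{γZ⋆}] = (1−λ) ∑_{j=1}^{∞} e^{(γ−λ)j} λ^{j−1} j^{j+1}/j! ≤ (1−λ)e^{−δ} / ( λ√(2π)(1−e^{−δ})² ). -/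
open scoped BigOperators

/-- Stirling's lower bound on the factorial, in a form uniform in `j ≥ 1`. -/
lemma sqrt_two_pi_mul_div_exp_pow_le_factorial {j : ℕ} (hj : j ≠ 0) :
    √(2 * Real.pi) * ((j : ℝ) / Real.exp 1) ^ j ≤ (Nat.factorial j : ℝ) := by
  refine le_trans ?_ (Stirling.le_factorial_stirling j)
  have h1 : (1 : ℝ) ≤ j := by exact_mod_cast Nat.one_le_iff_ne_zero.mpr hj
  have h2 : 2 * Real.pi ≤ 2 * Real.pi * j :=
    le_mul_of_one_le_right (by positivity) h1
  gcongr

lemma borel_exp_moment_term_eq {lam δ γ : ℝ} (hlam : 0 < lam)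
    (hγ : γ = lam - Real.log lam - 1 - δ) (j : ℕ) :
    Real.exp ((γ - lam) * j) * lam ^ (j - 1) * (j : ℝ) ^ (j + 1) / (Nat.factorial j)
      = lam⁻¹ * (j * Real.exp (-δ) ^ j) * (((j : ℝ) / Real.exp 1) ^ j / (Nat.factorial j)) := by
  rcases j with _ | k
  · simp
  have hexp : Real.exp (γ - lam) = lam⁻¹ * Real.exp (-δ) / Real.exp 1 := by
    rw [hγ, show lam - Real.log lam - 1 - δ - lam = -Real.log lam + -δ - 1 by ring,
      Real.exp_sub, Real.exp_add, Real.exp_neg, Real.exp_log hlam]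
  rw [mul_comm (γ - lam), Real.exp_nat_mul, hexp, Nat.add_sub_cancel]
  simp only [div_pow, mul_pow, inv_pow]
  field_simp
  ring

lemma borel_exp_moment_term_le {lam δ γ : ℝ} (hlam : 0 < lam)
    (hγ : γ = lam - Real.log lam - 1 - δ) (j : ℕ) :
    Real.exp ((γ - lam) * j) * lam ^ (j - 1) * (j : ℝ) ^ (j + 1) / (Nat.factorial j)
      ≤ (lam * √(2 * Real.pi))⁻¹ * (j * Real.exp (-δ) ^ j) := by
  rw [borel_exp_moment_term_eq hlam hγ]
  rcases eq_or_ne j 0 with rfl | hj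
  · simp
  have h : ((j : ℝ) / Real.exp 1) ^ j / (Nat.factorial j) ≤ (√(2 * Real.pi))⁻¹ := by
    rw [div_le_iff₀ (by positivity), inv_mul_eq_div, le_div_iff₀ (by positivity), mul_comm]
    exact sqrt_two_pi_mul_div_exp_pow_le_factorial hj
  calc _ ≤ lam⁻¹ * (j * Real.exp (-δ) ^ j) * (√(2 * Real.pi))⁻¹ := by gcongr
    _ = _ := by rw [mul_inv]; ring

lemma size_biased_borel_term_eq (lam γ : ℝ) (j : ℕ) :
    (j : ℝ) * Real.exp (γ * j) * ((1 - lam) * (j : ℝ) * borelPMF lam j)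
      = (1 - lam) * (Real.exp ((γ - lam) * j) * lam ^ (j - 1) * (j : ℝ) ^ (j + 1)
          / (Nat.factorial j)) := by
  rcases j with _ | k
  · simp
  rw [borelPMF, if_neg k.succ_ne_zero, sub_mul γ, sub_eq_add_neg (γ * _), Real.exp_add,
    Nat.add_sub_cancel, mul_pow]
  ring

/-- The exponential-moment bound for the size-biased Borel distribution: with
`γ = λ - log λ - 1 - δ > 0` and `P(Z⋆ = j) = (1-λ) j q(j)`,
`E[Z⋆ e^{γZ⋆}] = (1-λ) ∑_{j≥1} e^{(γ-λ)j} λ^{j-1} j^{j+1}/j!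
  ≤ (1-λ)e^{-δ}/(λ√(2π)(1-e^{-δ})²)`. -/
theorem borel_size_biased_exp_moment (lam δ γ : ℝ) (hlam0 : 0 < lam) (hlam1 : lam < 1)
    (hδ : 0 < δ) (hγ : γ = lam - Real.log lam - 1 - δ) (hγpos : 0 < γ) :
    (∑' j : ℕ, (j : ℝ) * Real.exp (γ * j) * ((1 - lam) * (j : ℝ) * borelPMF lam j)
        = (1 - lam) *
          ∑' j : ℕ, Real.exp ((γ - lam) * j) * lam ^ (j - 1) * (j : ℝ) ^ (j + 1)
            / (Nat.factorial j)) ∧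
      (1 - lam) *
          (∑' j : ℕ, Real.exp ((γ - lam) * j) * lam ^ (j - 1) * (j : ℝ) ^ (j + 1)
            / (Nat.factorial j))
        ≤ (1 - lam) * Real.exp (-δ)
            / (lam * Real.sqrt (2 * Real.pi) * (1 - Real.exp (-δ)) ^ 2) := by
  refine ⟨by simp_rw [size_biased_borel_term_eq]; exact tsum_mul_left, ?_⟩
  have hr : ‖Real.exp (-δ)‖ < 1 := by
    rw [Real.norm_of_nonneg (Real.exp_pos _).le]
    simpa using hδ
  have hsum := (hasSum_coe_mul_geometric_of_norm_lt_one hr).mul_left (lam * √(2 * Real.pi))⁻¹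
  have hle := borel_exp_moment_term_le (δ := δ) hlam0 hγ
  have hsummable := Summable.of_nonneg_of_le (fun j => by positivity) hle hsum.summable
  calc _ ≤ (1 - lam) * ((lam * √(2 * Real.pi))⁻¹ *
          (Real.exp (-δ) / (1 - Real.exp (-δ)) ^ 2)) :=
        mul_le_mul_of_nonneg_left (hasSum_le hle hsummable.hasSum hsum) (sub_nonneg.mpr hlam1.le)
    _ = _ := by
        rw [inv_mul_eq_div, div_div, mul_comm (_ ^ 2), mul_div_assoc]
end
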